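/- arXiv:2511.16562 — 3 statements merged into one kernel-verified Lean document; each statement's English description precedes it below -/
import Mathlib

section
/- For every n ≥ 0 and every 0 ≤ j ≤ n, one has ∑_{0 ≤ k ≤ n, k ≠ j} d_{n,k} ≡ −1 (mod d_{n,j}). -/
/-- The Sylvester sequence: `s 0 = 2`, `s (n+1) = 1 + s 0 * s 1 * ⋯ * s n`. -/
def syl : ℕ → ℕ
  | 0 => 2
  | n + 1 => 1 + ∏ k ∈ (Finset.range (n + 1)).attach, syl k.1
decreasing_by exact Finset.mem_range.mp k.2

/-- `d n = ∏_{k=0}^{n} s k`. -/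
def dS (n : ℕ) : ℕ := ∏ k ∈ Finset.range (n + 1), syl k

/-- `d⟨n,j⟩ = d n / s j`. -/
def dSj (n j : ℕ) : ℕ := dS n / syl j

theorem syl_zero : syl 0 = 2 := by
  rw [syl]

theorem syl_succ (n : ℕ) : syl (n + 1) = 1 + dS n := by
  rw [syl, dS, Finset.prod_attach (Finset.range (n + 1)) syl]

theorem syl_pos (n : ℕ) : 0 < syl n := by
  cases n with
  | zero => simp [syl_zero]
  | succ n => rw [syl_succ]; omega

theorem dS_succ (n : ℕ) : dS (n + 1) = dS n * syl (n + 1) :=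
  Finset.prod_range_succ syl (n + 1)

theorem syl_dvd_dS {n j : ℕ} (hj : j ≤ n) : syl j ∣ dS n :=
  Finset.dvd_prod_of_mem syl (Finset.mem_range.mpr (Nat.lt_succ_of_le hj))

theorem dSj_succ_of_le {n j : ℕ} (hj : j ≤ n) : dSj (n + 1) j = dSj n j * syl (n + 1) := by
  rw [dSj, dSj, dS_succ, Nat.div_mul_right_comm (syl_dvd_dS hj)]

theorem dSj_succ_self (n : ℕ) : dSj (n + 1) (n + 1) = dS n := by
  rw [dSj, dS_succ, Nat.mul_div_cancel _ (syl_pos _)]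

/-- The integer form of `∑_{k ≤ n} 1 / s k = 1 - 1 / d n`. -/
theorem sum_dSj_add_one (n : ℕ) : ∑ k ∈ Finset.range (n + 1), dSj n k + 1 = dS n := by
  induction n with
  | zero => simp [dSj, dS, syl_zero]
  | succ n ih =>
    rw [Finset.sum_range_succ, dSj_succ_self,
      Finset.sum_congr rfl fun k hk =>
        dSj_succ_of_le (Nat.le_of_lt_succ (Finset.mem_range.mp hk)),
      ← Finset.sum_mul, dS_succ, syl_succ, ← ih]
    ring

/-- For every `n ≥ 0` and `0 ≤ j ≤ n`, one has
`∑_{0 ≤ k ≤ n, k ≠ j} d_{n,k} ≡ −1 (mod d_{n,j})`. -/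
theorem sum_dSj_modeq_neg_one (n j : ℕ) (hj : j ≤ n) :
    ((∑ k ∈ (Finset.range (n + 1)).erase j, dSj n k : ℕ) : ℤ) ≡ -1 [ZMOD (dSj n j : ℤ)] := by
  have hmem : j ∈ Finset.range (n + 1) := Finset.mem_range.mpr (Nat.lt_succ_of_le hj)
  have hsum := sum_dSj_add_one n
  rw [← Finset.sum_erase_add _ _ hmem] at hsum
  have hmul : dSj n j * syl j = dS n := Nat.div_mul_cancel (syl_dvd_dS hj)
  rw [← hmul] at hsum
  zify at hsum
  refine (Int.modEq_iff_dvd.mpr ⟨1 - (syl j : ℤ), ?_⟩)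
  push_cast
  linear_combination -hsum
end

section
/- Let n ≥ 0 and let i_0, …, i_n be integers with 0 ≤ i_k ≤ s_k − 1 for each k and ∑_{k=0}^{n} d_{n,k} i_k < d_n, and let j be an index with i_j ≠ 0. Then s_j divides the positive integer d_n − ∑_{k ≠ j} d_{n,k} i_k, and the rational number w_j := (d_n − ∑_{k ≠ j} d_{n,k} i_k)/i_j satisfies w_j ≥ d_{n,j} + 1; equivalently, ∑_{k ≠ j} d_{n,k} + w_j ≥ d_n. -/
theorem dSj_mul_syl {n k : ℕ} (hk : k ≤ n) : dSj n k * syl k = dS n :=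
  Nat.div_mul_cancel (Finset.dvd_prod_of_mem syl (by simpa [Nat.lt_succ_iff] using hk))

theorem dSj_eq_prod_erase {n k : ℕ} (hk : k ≤ n) :
    dSj n k = ∏ l ∈ (Finset.range (n + 1)).erase k, syl l := by
  apply Nat.eq_of_mul_eq_mul_right (syl_pos k)
  rw [dSj_mul_syl hk, dS, Finset.prod_erase_mul _ _ (by simpa [Nat.lt_succ_iff] using hk)]

theorem syl_dvd_dSj {n j k : ℕ} (hj : j ≤ n) (hk : k ≤ n) (hjk : j ≠ k) :
    syl j ∣ dSj n k := by
  rw [dSj_eq_prod_erase hk]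
  exact Finset.dvd_prod_of_mem syl (by simp; omega)

theorem syl_dvd_sum_erase {n j : ℕ} (hj : j ≤ n) (i : ℕ → ℕ) :
    syl j ∣ ∑ k ∈ (Finset.range (n + 1)).erase j, dSj n k * i k := by
  refine Finset.dvd_sum fun k hk => ?_
  simp only [Finset.mem_erase, Finset.mem_range] at hk
  exact (syl_dvd_dSj hj (by omega) (Ne.symm hk.1)).mul_right _

theorem sum_erase_add_dSj {n j : ℕ} (hj : j ≤ n) :
    ∑ k ∈ (Finset.range (n + 1)).erase j, dSj n k + (dSj n j + 1) = dS n := by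
  rw [← add_assoc, Finset.sum_erase_add _ _ (by simpa [Nat.lt_succ_iff] using hj),
    sum_dSj_add_one]

theorem syl_dvd_dSj_add_one {n j : ℕ} (hj : j ≤ n) : syl j ∣ dSj n j + 1 := by
  have h := syl_dvd_sum_erase hj fun _ => 1
  simp only [mul_one] at h
  exact (Nat.dvd_add_right h).1 (sum_erase_add_dSj hj ▸ syl_dvd_dS hj)

/-- If `0 ≤ i_k ≤ s_k − 1` for `0 ≤ k ≤ n`, `∑_{k=0}^{n} d_{n,k} i_k < d_n`, and `i_j ≠ 0`,
then `s_j` divides the positive integer `d_n − ∑_{k ≠ j} d_{n,k} i_k`, and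
`w_j := (d_n − ∑_{k ≠ j} d_{n,k} i_k)/i_j` satisfies `w_j ≥ d_{n,j} + 1`; equivalently,
`∑_{k ≠ j} d_{n,k} + w_j ≥ d_n`. -/
theorem newton_weight_inequality (n : ℕ) (i : ℕ → ℕ)
    (hi : ∀ k, k ≤ n → i k ≤ syl k - 1)
    (hsum : ∑ k ∈ Finset.range (n + 1), dSj n k * i k < dS n)
    (j : ℕ) (hj : j ≤ n) (hij : i j ≠ 0) :
    0 < (dS n : ℤ) - ∑ k ∈ (Finset.range (n + 1)).erase j, (dSj n k : ℤ) * (i k : ℤ) ∧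
    (syl j : ℤ) ∣
      ((dS n : ℤ) - ∑ k ∈ (Finset.range (n + 1)).erase j, (dSj n k : ℤ) * (i k : ℤ)) ∧
    ((dS n : ℚ) - ∑ k ∈ (Finset.range (n + 1)).erase j, (dSj n k : ℚ) * (i k : ℚ)) / (i j : ℚ)
      ≥ (dSj n j : ℚ) + 1 ∧
    (∑ k ∈ (Finset.range (n + 1)).erase j, (dSj n k : ℚ)) +
      ((dS n : ℚ) - ∑ k ∈ (Finset.range (n + 1)).erase j, (dSj n k : ℚ) * (i k : ℚ)) / (i j : ℚ)
      ≥ (dS n : ℚ) := by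
  have hmem : j ∈ Finset.range (n + 1) := by simpa [Nat.lt_succ_iff] using hj
  rw [← Finset.sum_erase_add _ _ hmem] at hsum
  have hdvd := syl_dvd_sum_erase hj i
  have hij_le := hi j hj
  have hsyl := syl_pos j
  have hfill := sum_erase_add_dSj hj
  set S := ∑ k ∈ (Finset.range (n + 1)).erase j, dSj n k * i k with hS
  have hcast : ∑ k ∈ (Finset.range (n + 1)).erase j, (dSj n k : ℤ) * (i k : ℤ) = S := by
    simp [hS]
  have hcastQ : ∑ k ∈ (Finset.range (n + 1)).erase j, (dSj n k : ℚ) * (i k : ℚ) = S := by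
    simp [hS]
  have hN : (syl j : ℤ) ∣ (dS n : ℤ) - S :=
    dvd_sub (Int.natCast_dvd_natCast.2 (syl_dvd_dS hj)) (Int.natCast_dvd_natCast.2 hdvd)
  have hone : (syl j : ℤ) ∣ (dSj n j : ℤ) + 1 := by
    exact_mod_cast syl_dvd_dSj_add_one hj
  have hres : (syl j : ℤ) ∣ (dSj n j + 1) * i j - ((dS n : ℤ) - S) :=
    dvd_sub (hone.mul_right _) hN
  zify at hsum
  have hkey : ((dSj n j : ℤ) + 1) * i j ≤ (dS n : ℤ) - S := by
    by_contra! hlt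
    have hle := Int.le_of_dvd (by linarith) hres
    have : (i j : ℤ) < syl j := by omega
    linarith
  have hkeyQ : ((dSj n j : ℚ) + 1) * i j ≤ (dS n : ℚ) - S := by exact_mod_cast hkey
  have hpos : (0 : ℚ) < i j := by exact_mod_cast Nat.pos_of_ne_zero hij
  have hw := (le_div_iff₀ hpos).2 hkeyQ
  have hfillQ : ∑ k ∈ (Finset.range (n + 1)).erase j, (dSj n k : ℚ) + ((dSj n j : ℚ) + 1)
      = dS n := by
    exact_mod_cast hfill
  rw [hcast, hcastQ]
  refine ⟨?_, hN, hw, by linarith⟩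
  have : (0 : ℤ) ≤ (dSj n j : ℤ) * i j := by positivity
  linarith
end

section
/- The number of n-tuples of integers (i_1, …, i_n) with 0 ≤ i_k ≤ s_k − 2 for 1 ≤ k ≤ n and i_1/s_1 + i_2/s_2 + ⋯ + i_n/s_n < 1 equals 2 for n = 1, 11 for n = 2, 252 for n = 3, 151701 for n = 4, and 123769377142 for n = 5. -/
/-- The number of `n`-tuples `(i_1, …, i_n)` with `0 ≤ i_k ≤ s_k − 2` and
`∑_{k=1}^{n} i_k/s_k < 1`. -/
noncomputable def posWeightCount (n : ℕ) : ℕ :=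
  Nat.card {i : Fin n → ℕ //
    (∀ k : Fin n, i k ≤ syl ((k : ℕ) + 1) - 2) ∧
    (∑ k : Fin n, (i k : ℚ) / (syl ((k : ℕ) + 1) : ℚ)) < 1}

/-- The number of leaves, weighted by `g`, of the tree of tuples extending a state `(D, r)`, in
which the remaining budget is `r / D` and the next denominator is `2 * D + 1`. -/
def extCount (g : ℕ → ℕ → ℕ) : ℕ → ℕ → ℕ → ℕ
  | 0, D, r => g D r
  | n + 1, D, r => ∑ j ∈ Finset.range (min (2 * r + 1) (2 * D)),
      extCount g n (D * (2 * D + 1)) ((2 * D + 1) * r - D * j)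

/-- Closed form for the number of extensions of the state `(D, r)` by two entries. -/
def extTwo (D r : ℕ) : ℕ :=
  if r < D then (2 * r + 1) * (2 * (D + 1) * r + 1)
  else 2 * D * (2 * D * D + 3 * D + 1) - 1

theorem mul_lt_of_lt_min {D r j : ℕ} (hr : 0 < r) (hj : j < min (2 * r + 1) (2 * D)) :
    D * j < (2 * D + 1) * r := by
  have : j ≤ 2 * r := by omega
  nlinarith [Nat.mul_le_mul_left D this]

theorem extCount_congr {g h : ℕ → ℕ → ℕ} (H : ∀ D r, 0 < r → r ≤ D → g D r = h D r) (n : ℕ) :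
    ∀ D r, 0 < r → r ≤ D → extCount g n D r = extCount h n D r := by
  induction n with
  | zero => exact H
  | succ n ih =>
    intro D r hr hD
    refine Finset.sum_congr rfl fun j hj => ih _ _ ?_ ?_
    · have := mul_lt_of_lt_min hr (Finset.mem_range.mp hj)
      omega
    · calc (2 * D + 1) * r - D * j ≤ (2 * D + 1) * r := Nat.sub_le _ _
        _ ≤ (2 * D + 1) * D := Nat.mul_le_mul_left _ hD
        _ = D * (2 * D + 1) := Nat.mul_comm _ _

theorem extCount_add (g : ℕ → ℕ → ℕ) (m n : ℕ) :
    ∀ D r, extCount g (n + m) D r = extCount (extCount g m) n D r := by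
  induction n with
  | zero => intro D r; rw [Nat.zero_add]; rfl
  | succ n ih =>
    intro D r
    rw [Nat.succ_add]
    exact Finset.sum_congr rfl fun j _ => ih _ _

theorem sum_range_sub_mul (c d : ℤ) (m : ℕ) :
    ∑ j ∈ Finset.range m, (c - 2 * d * j) = m * c - d * m * (m - 1) := by
  induction m with
  | zero => simp
  | succ m ih => rw [Finset.sum_range_succ, ih]; push_cast; ring

theorem extCount_two {D r : ℕ} (hr : 0 < r) (hD : r ≤ D) :
    extCount (fun _ _ => 1) 2 D r = extTwo D r := by
  have key : ∀ j ∈ Finset.range (min (2 * r + 1) (2 * D)),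
      ((min (2 * ((2 * D + 1) * r - D * j) + 1) (2 * (D * (2 * D + 1))) : ℕ) : ℤ)
        = ((2 * (2 * D + 1) * r + 1) - 2 * D * j) -
            if j = 0 then (if r < D then 0 else 1) else 0 := by
    intro j hj
    have h1 := mul_lt_of_lt_min hr (Finset.mem_range.mp hj)
    split_ifs with h0 h
    · have h2 : (2 * D + 1) * r < D * (2 * D + 1) := by nlinarith
      rw [min_eq_left (by omega)]
      push_cast [Nat.cast_sub h1.le]
      ring
    · obtain rfl : r = D := by omega
      subst h0
      rw [Nat.mul_zero, Nat.sub_zero, Nat.mul_comm r (2 * r + 1), min_eq_right (by omega)]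
      push_cast
      ring
    · have h2 : (2 * D + 1) * r ≤ D * (2 * D + 1) := by nlinarith
      have h3 : 0 < D * j := Nat.mul_pos (by omega) (by omega)
      rw [min_eq_left (by omega)]
      push_cast [Nat.cast_sub h1.le]
      ring
  have total := Finset.sum_congr rfl key
  rw [← Nat.cast_sum, Finset.sum_sub_distrib, Finset.sum_ite_eq',
    if_pos (Finset.mem_range.mpr (by omega)), sum_range_sub_mul] at total
  simp only [extCount, Finset.sum_const, Finset.card_range, smul_eq_mul, mul_one, extTwo]
  split_ifs at total ⊢ with h
  · rw [min_eq_left (by omega : 2 * r + 1 ≤ 2 * D)] at total ⊢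
    zify
    push_cast at total ⊢
    rw [total]
    ring
  · obtain rfl : r = D := by omega
    rw [min_eq_right (by omega : 2 * r ≤ 2 * r + 1)] at total ⊢
    have : 0 < 2 * r * (2 * r * r + 3 * r + 1) := by positivity
    zify [this]
    push_cast at total ⊢
    rw [total]
    ring

theorem syl_succ_s13 (m : ℕ) : syl (m + 1) = 1 + ∏ k ∈ Finset.range (m + 1), syl k := by
  rw [syl, Finset.prod_attach (Finset.range (m + 1)) syl]

/-- The product `s 1 * ⋯ * s m`. -/
def oddProd (m : ℕ) : ℕ := ∏ k ∈ Finset.range m, syl (k + 1)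

theorem syl_succ_eq (m : ℕ) : syl (m + 1) = 2 * oddProd m + 1 := by
  rw [syl_succ_s13, Finset.prod_range_succ', oddProd, syl]
  ring

theorem oddProd_succ (m : ℕ) : oddProd (m + 1) = oddProd m * (2 * oddProd m + 1) := by
  rw [oddProd, Finset.prod_range_succ, ← oddProd, syl_succ_eq]

theorem oddProd_pos (m : ℕ) : 0 < oddProd m :=
  Finset.prod_pos fun k _ => by rw [syl_succ_eq]; omega

/-- The tuples with denominators `s (m+1), …, s (m+n)` and budget `r / (s 1 * ⋯ * s m)`. -/
def tuples (n m r : ℕ) : Set (Fin n → ℕ) :=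
  {i | (∀ k : Fin n, i k ≤ syl (m + k + 1) - 2) ∧
    ∑ k : Fin n, (i k : ℚ) / (syl (m + k + 1) : ℚ) < (r : ℚ) / (oddProd m : ℚ)}

theorem cons_mem_tuples {n m r : ℕ} (hr : 0 < r) (hD : r ≤ oddProd m) (j : ℕ) (i : Fin n → ℕ) :
    (Fin.cons j i : Fin (n + 1) → ℕ) ∈ tuples (n + 1) m r ↔
      j < min (2 * r + 1) (2 * oddProd m) ∧
        i ∈ tuples n (m + 1) ((2 * oddProd m + 1) * r - oddProd m * j) := by
  have hp := oddProd_pos m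
  have hq : (0 : ℚ) < oddProd m := by exact_mod_cast hp
  simp only [tuples, Set.mem_ofPred_eq, Fin.forall_fin_succ, Fin.sum_univ_succ, Fin.cons_zero,
    Fin.cons_succ, Fin.val_zero, Fin.val_succ, add_zero, syl_succ_eq m]
  have e : ∀ k : ℕ, m + (k + 1) + 1 = m + 1 + k + 1 := fun k => by ring
  simp only [e]
  set S : ℚ := ∑ k : Fin n, (i k : ℚ) / (syl (m + 1 + k + 1) : ℚ) with hS
  have hS0 : 0 ≤ S := Finset.sum_nonneg fun k _ => by positivity
  have budget (hj : oddProd m * j < (2 * oddProd m + 1) * r) :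
      (((2 * oddProd m + 1) * r - oddProd m * j : ℕ) : ℚ) / (oddProd (m + 1) : ℚ)
        = (r : ℚ) / oddProd m - (j : ℚ) / ((2 * oddProd m + 1 : ℕ) : ℚ) := by
    rw [oddProd_succ]
    push_cast [Nat.cast_sub hj.le]
    field_simp
  constructor
  · rintro ⟨⟨h1, h2⟩, h3⟩
    have h4 : oddProd m * j < (2 * oddProd m + 1) * r := by
      have h5 : (j : ℚ) / ((2 * oddProd m + 1 : ℕ) : ℚ) < (r : ℚ) / oddProd m := by linarith
      rw [div_lt_div_iff₀ (by positivity) hq] at h5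
      have h6 : j * oddProd m < r * (2 * oddProd m + 1) := by exact_mod_cast h5
      linarith
    refine ⟨lt_min ?_ (by omega), h2, ?_⟩
    · by_contra! h
      nlinarith [Nat.mul_le_mul_left (oddProd m) h]
    · rw [budget h4]; linarith
  · rintro ⟨h1, h2, h3⟩
    rw [budget (mul_lt_of_lt_min hr h1)] at h3
    exact ⟨⟨by omega, h2⟩, by linarith⟩

theorem tuples_finite (n m r : ℕ) : (tuples n m r).Finite :=
  (Set.finite_Iic fun k : Fin n => syl (m + k + 1) - 2).subset fun _ h => h.1

/-- Splitting off the first entry of a tuple. -/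
def tuplesSuccEquiv {n m r : ℕ} (hr : 0 < r) (hD : r ≤ oddProd m) :
    tuples (n + 1) m r ≃ Σ j : Fin (min (2 * r + 1) (2 * oddProd m)),
      tuples n (m + 1) ((2 * oddProd m + 1) * r - oddProd m * j) where
  toFun x :=
    have h := (cons_mem_tuples hr hD (x.1 0) (Fin.tail x.1)).mp
      (by rw [Fin.cons_self_tail]; exact x.2)
    ⟨⟨x.1 0, h.1⟩, ⟨Fin.tail x.1, h.2⟩⟩
  invFun y := ⟨Fin.cons y.1.1 y.2.1, (cons_mem_tuples hr hD _ _).mpr ⟨y.1.2, y.2.2⟩⟩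
  left_inv x := Subtype.ext (Fin.cons_self_tail x.1)
  right_inv _ := rfl

theorem card_tuples (n : ℕ) : ∀ m r, 0 < r → r ≤ oddProd m →
    Nat.card (tuples n m r) = extCount (fun _ _ => 1) n (oddProd m) r := by
  induction n with
  | zero =>
    intro m r hr _
    have hp := oddProd_pos m
    have : tuples 0 m r = Set.univ := by
      ext i
      have : (0 : ℚ) < (r : ℚ) / (oddProd m : ℚ) := by positivity
      simp [tuples, this]
    simp [this, extCount]
  | succ n ih =>
    intro m r hr hD
    have (j : Fin (min (2 * r + 1) (2 * oddProd m))) :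
        Finite (tuples n (m + 1) ((2 * oddProd m + 1) * r - oddProd m * j)) :=
      tuples_finite _ _ _
    rw [Nat.card_congr (tuplesSuccEquiv hr hD), Nat.card_sigma, extCount, Finset.sum_range]
    refine Finset.sum_congr rfl fun j _ => ?_
    rw [ih, oddProd_succ]
    · have := mul_lt_of_lt_min hr j.2
      omega
    · rw [oddProd_succ]
      calc (2 * oddProd m + 1) * r - oddProd m * j ≤ (2 * oddProd m + 1) * r := Nat.sub_le _ _
        _ ≤ (2 * oddProd m + 1) * oddProd m := Nat.mul_le_mul_left _ hD
        _ = oddProd m * (2 * oddProd m + 1) := Nat.mul_comm _ _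

theorem posWeightCount_eq (n : ℕ) : posWeightCount n = extCount (fun _ _ => 1) n 1 1 := by
  have h := card_tuples n 0 1 one_pos (by simp [oddProd])
  rw [show oddProd 0 = 1 from rfl] at h
  rw [← h, posWeightCount]
  refine Nat.card_congr (Equiv.subtypeEquivRight fun i => ?_)
  simp [oddProd, tuples]

theorem posWeightCount_add_two (n : ℕ) : posWeightCount (n + 2) = extCount extTwo n 1 1 := by
  rw [posWeightCount_eq, extCount_add]
  exact extCount_congr (fun _ _ => extCount_two) n 1 1 one_pos le_rfl

/-- The count of positive-weight monomials equals `2, 11, 252, 151701, 123769377142`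
for `n = 1, 2, 3, 4, 5`. -/
theorem posWeightCount_values :
    posWeightCount 1 = 2 ∧ posWeightCount 2 = 11 ∧ posWeightCount 3 = 252 ∧
    posWeightCount 4 = 151701 ∧ posWeightCount 5 = 123769377142 := by
  rw [posWeightCount_eq 1, posWeightCount_add_two 0, posWeightCount_add_two 1,
    posWeightCount_add_two 2, posWeightCount_add_two 3]
  decide +kernel
end
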